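/- Consider the scale-mixture Bayes factor B10^mix(θ̂) defined below with ν0 < ν1. Then the condition ∫₀^∞ (g+1)^{(n−r1−r2+ν1)/2} π(g) dg = ∞ is necessary for information consistency: if this integral is finite, then B10^mix(θ̂) stays bounded (in fact tends to 0) along |θ̂| → ∞, so B10^mix is information inconsistent. -/

import Mathlib

open MeasureTheory Filter Matrix

lemma aux_scale {r : ℕ} (A : Matrix (Fin r) (Fin r) ℝ) (θ : EuclideanSpace ℝ (Fin r)) (h : θ ≠ 0) :
    ∃ u ∈ Metric.sphere (0 : EuclideanSpace ℝ (Fin r)) 1,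
      θ ⬝ᵥ A.mulVec θ = ‖θ‖ ^ 2 * (u ⬝ᵥ A.mulVec u) := by
  have hn : ‖θ‖ ≠ 0 := norm_ne_zero_iff.mpr h
  refine ⟨‖θ‖⁻¹ • θ, ?_, ?_⟩
  · simp [norm_smul, hn]
  · simp only [WithLp.ofLp_smul, Matrix.mulVec_smul, smul_dotProduct, dotProduct_smul, smul_eq_mul]
    field_simp

lemma aux_upper {r : ℕ} (A : Matrix (Fin r) (Fin r) ℝ) :
    ∃ C : ℝ, 0 < C ∧ ∀ θ : EuclideanSpace ℝ (Fin r), θ ⬝ᵥ A.mulVec θ ≤ C * ‖θ‖ ^ 2 := by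
  have hc : Continuous (fun u : EuclideanSpace ℝ (Fin r) => u ⬝ᵥ A.mulVec u) := by fun_prop
  obtain ⟨C, hC⟩ := (isCompact_sphere (0 : EuclideanSpace ℝ (Fin r)) 1).bddAbove_image hc.continuousOn
  refine ⟨max C 1, by positivity, fun θ => ?_⟩
  by_cases h : θ = 0
  · simp [h]
  obtain ⟨u, hu, he⟩ := aux_scale A θ h
  rw [he, mul_comm]
  have := hC (Set.mem_image_of_mem _ hu)
  gcongr
  exact le_trans this (le_max_left _ _)

lemma aux_pd {r : ℕ} (Ω R : Matrix (Fin r) (Fin r) ℝ) (hΩ : Ω.PosDef) (hR : R.PosDef)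
    (t : ℝ) (ht : t ∈ Set.Icc (0:ℝ) 1) : (t • Ω + (1 - t) • R).PosDef := by
  rcases ht.1.eq_or_lt with h | h
  · subst h; simpa using hR
  · exact (hΩ.smul h).add_posSemidef (hR.posSemidef.smul (by linarith [ht.2]))

lemma aux_det {r : ℕ} (Ω R : Matrix (Fin r) (Fin r) ℝ) (hΩ : Ω.PosDef) (hR : R.PosDef) :
    ∃ d : ℝ, 0 < d ∧ ∀ t ∈ Set.Icc (0:ℝ) 1, d ≤ (t • Ω + (1 - t) • R).det := by
  have hc : Continuous (fun t : ℝ => (t • Ω + (1 - t) • R).det) := by fun_prop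
  obtain ⟨t0, h0, hm⟩ := (isCompact_Icc (a := (0:ℝ)) (b := 1)).exists_isMinOn
    ⟨0, by simp⟩ hc.continuousOn
  exact ⟨_, (aux_pd Ω R hΩ hR t0 h0).det_pos, fun t ht => hm ht⟩

lemma aux_quad {r : ℕ} (hr : 1 ≤ r) (Ω R : Matrix (Fin r) (Fin r) ℝ) (hΩ : Ω.PosDef) (hR : R.PosDef) :
    ∃ c : ℝ, 0 < c ∧ ∀ t ∈ Set.Icc (0:ℝ) 1, ∀ θ : EuclideanSpace ℝ (Fin r),
      c * ‖θ‖ ^ 2 ≤ θ ⬝ᵥ ((t • Ω + (1 - t) • R)⁻¹).mulVec θ := by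
  have : Nonempty (Fin r) := ⟨⟨0, hr⟩⟩
  let f : ℝ × EuclideanSpace ℝ (Fin r) → ℝ := fun p =>
    p.2 ⬝ᵥ ((p.1 • Ω + (1 - p.1) • R)⁻¹).mulVec p.2
  have hc : ContinuousOn f (Set.Icc (0:ℝ) 1 ×ˢ Metric.sphere (0 : EuclideanSpace ℝ (Fin r)) 1) := by
    have : f = fun p => (p.1 • Ω + (1 - p.1) • R).det⁻¹ *
        (p.2 ⬝ᵥ ((p.1 • Ω + (1 - p.1) • R).adjugate).mulVec p.2) := by
      funext p
      simp only [f, Matrix.inv_def, Matrix.smul_mulVec, dotProduct_smul, smul_eq_mul, Ring.inverse_eq_inv']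
    rw [this]
    apply ContinuousOn.mul
    · apply ContinuousOn.inv₀
      · apply Continuous.continuousOn
        fun_prop
      · intro p hp
        exact (aux_pd Ω R hΩ hR p.1 hp.1).det_pos.ne'
    · apply Continuous.continuousOn
      have h1 : Continuous fun p : ℝ × EuclideanSpace ℝ (Fin r) =>
        (p.1 • Ω + (1 - p.1) • R).adjugate := Continuous.matrix_adjugate (by fun_prop)
      have h2 : Continuous fun p : ℝ × EuclideanSpace ℝ (Fin r) => p.2.ofLp := by fun_prop
      exact Continuous.dotProduct h2 (Continuous.matrix_mulVec h1 h2)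
  obtain ⟨⟨t0, u0⟩, h0, hm⟩ := ((isCompact_Icc (a := (0:ℝ)) (b := 1)).prod
    (isCompact_sphere (0 : EuclideanSpace ℝ (Fin r)) 1)).exists_isMinOn
    (by
      refine Set.Nonempty.prod ⟨0, by simp⟩ ?_
      exact NormedSpace.sphere_nonempty.mpr zero_le_one) hc
  refine ⟨f (t0, u0), ?_, ?_⟩
  · have hp := (aux_pd Ω R hΩ hR t0 h0.1).inv
    have hne : u0.ofLp ≠ 0 := by
      intro h
      have h1 : u0 = 0 := by
        ext i; simp [h]
      have h2 := h0.2
      simp [h1] at h2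
    simpa using hp.dotProduct_mulVec_pos hne
  · intro t ht θ
    by_cases h : θ = 0
    · simp [h]
    obtain ⟨u, hu, he⟩ := aux_scale ((t • Ω + (1 - t) • R)⁻¹) θ h
    rw [he, mul_comm]
    have : f (t0, u0) ≤ f (t, u) := hm (show (t, u) ∈ _ from ⟨ht, hu⟩)
    gcongr

/-- Matrix bounds in terms of `g`. -/
lemma aux_g {r : ℕ} (hr : 1 ≤ r) (Ω R : Matrix (Fin r) (Fin r) ℝ) (hΩ : Ω.PosDef) (hR : R.PosDef) :
    ∃ d c : ℝ, 0 < d ∧ 0 < c ∧ ∀ g : ℝ, 0 < g →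
      d * (g + 1) ^ r ≤ (g • Ω + R).det ∧
      ∀ θ : EuclideanSpace ℝ (Fin r),
        c * ‖θ‖ ^ 2 / (g + 1) ≤ θ ⬝ᵥ ((g • Ω + R)⁻¹).mulVec θ := by
  obtain ⟨d, hd, hd'⟩ := aux_det Ω R hΩ hR
  obtain ⟨c, hc, hc'⟩ := aux_quad hr Ω R hΩ hR
  refine ⟨d, c, hd, hc, fun g hg => ?_⟩
  have hg1 : 0 < g + 1 := by linarith
  have ht : g / (g + 1) ∈ Set.Icc (0:ℝ) 1 := ⟨by positivity, by rw [div_le_one hg1]; linarith⟩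
  have he : g • Ω + R = (g + 1) • ((g / (g + 1)) • Ω + (1 - g / (g + 1)) • R) := by
    rw [smul_add, smul_smul, smul_smul, mul_div_cancel₀ _ hg1.ne',
      show (g + 1) * (1 - g / (g + 1)) = 1 by field_simp; ring, one_smul]
  have hpd := aux_pd Ω R hΩ hR _ ht
  have h1 := hd' _ ht
  have h2 := hc' _ ht
  rw [he]
  generalize (g / (g + 1)) • Ω + (1 - g / (g + 1)) • R = N at hpd h1 h2
  constructor
  · rw [Matrix.det_smul, Fintype.card_fin, mul_comm]
    gcongr
  · intro θ
    have hinv : ((g + 1) • N)⁻¹ = (g + 1)⁻¹ • N⁻¹ := by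
      apply Matrix.inv_eq_left_inv
      rw [Matrix.smul_mul, Matrix.mul_smul, smul_smul, inv_mul_cancel₀ hg1.ne', one_smul,
        Matrix.nonsing_inv_mul _ hpd.det_pos.ne'.isUnit]
    rw [hinv, Matrix.smul_mulVec, dotProduct_smul, smul_eq_mul, div_eq_inv_mul]
    gcongr
    exact h2 θ

/-- For the scale-mixture Bayes factor with ν0 < ν1, the condition
∫₀^∞ (g+1)^{(n−r1−r2+ν1)/2} π(g) dg = ∞ is necessary for information consistency:
if the integral is finite then B10^mix tends to 0 (in particular it does not tend to ∞)
as |θ̂| → ∞, so B10^mix is information inconsistent. -/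
theorem mixture_bayes_factor_necessary_condition_of_nu0_lt_nu1
    (n r1 r2 : ℕ) (hn : 1 ≤ n) (hr1 : 1 ≤ r1)
    (Q Ω : Matrix (Fin r1) (Fin r1) ℝ) (hQ : Q.PosDef) (hΩ : Ω.PosDef)
    (ν0 ν1 : ℝ) (hν0 : 0 ≤ ν0) (hν1 : 0 ≤ ν1)
    (hdf : 0 < (n : ℝ) - r1 - r2 + ν1)
    (s0sq s1sq : ℝ) (hs0 : 0 < s0sq) (hs1 : 0 < s1sq)
    (sysq : ℝ) (hsy : 0 < sysq)
    (pri : ℝ → ℝ) (hpri_meas : Measurable pri)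
    (hpri_nonneg : ∀ g ∈ Set.Ioi (0:ℝ), 0 ≤ pri g)
    (hpri_int : ∫ g in Set.Ioi (0:ℝ), pri g = 1)
    (Bmix : EuclideanSpace ℝ (Fin r1) → ℝ)
    (hBmix : ∀ θhat : EuclideanSpace ℝ (Fin r1),
      Bmix θhat =
        (∫ g in Set.Ioi (0:ℝ),
          (g • Ω + Q⁻¹).det ^ (-(1:ℝ)/2) *
            (ν1 * s1sq + sysq + θhat ⬝ᵥ ((g • Ω + Q⁻¹)⁻¹).mulVec θhat)
              ^ (-(((n:ℝ) - r2 + ν1) / 2)) * pri g) /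
        (ν0 * s0sq + sysq + θhat ⬝ᵥ Q.mulVec θhat)
          ^ (-(((n:ℝ) - r2 + ν0) / 2)))
    (hν : ν0 < ν1)
    (hint : IntegrableOn (fun g : ℝ => (g + 1) ^ (((n:ℝ) - r1 - r2 + ν1) / 2) * pri g)
      (Set.Ioi (0:ℝ))) :
    Tendsto Bmix (comap (fun θhat : EuclideanSpace ℝ (Fin r1) => ‖θhat‖) atTop) (nhds 0) ∧
    ¬ Tendsto Bmix (comap (fun θhat : EuclideanSpace ℝ (Fin r1) => ‖θhat‖) atTop) atTop := by
  have hR := hQ.inv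
  obtain ⟨d, c, hd, hc, hdc⟩ := aux_g hr1 Ω Q⁻¹ hΩ hR
  obtain ⟨K, hK, hKq⟩ := aux_upper Q
  set a : ℝ := ((n:ℝ) - r2 + ν1) / 2 with ha
  set b : ℝ := ((n:ℝ) - r2 + ν0) / 2 with hb
  have hr1' : (1:ℝ) ≤ r1 := by exact_mod_cast hr1
  have ha0 : 0 < a := by rw [ha]; linarith
  have hba : b < a := by rw [ha, hb]; linarith
  set S0 : ℝ := ν0 * s0sq + sysq with hS0
  have hS0p : 0 < S0 := by positivity
  set S1 : ℝ := ν1 * s1sq + sysq with hS1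
  have hS1p : 0 < S1 := by positivity
  have hQn : ∀ θ : EuclideanSpace ℝ (Fin r1), 0 ≤ θ ⬝ᵥ Q.mulVec θ := fun θ => by
    simpa using hQ.posSemidef.dotProduct_mulVec_nonneg θ.ofLp
  set J : ℝ := ∫ g in Set.Ioi (0:ℝ), (g + 1) ^ (((n:ℝ) - r1 - r2 + ν1) / 2) * pri g with hJ
  have hJ0 : 0 ≤ J := by
    apply setIntegral_nonneg measurableSet_Ioi
    intro g hg
    have : (0:ℝ) < g := hg
    exact mul_nonneg (by positivity) (hpri_nonneg g hg)
  -- nonnegativity of the integrand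
  have hint0 : ∀ θ : EuclideanSpace ℝ (Fin r1), ∀ g ∈ Set.Ioi (0:ℝ),
      0 ≤ (g • Ω + Q⁻¹).det ^ (-(1:ℝ)/2) *
            (S1 + θ ⬝ᵥ ((g • Ω + Q⁻¹)⁻¹).mulVec θ) ^ (-a) * pri g := by
    intro θ g hg
    have hg0 : (0:ℝ) < g := hg
    obtain ⟨h1, h2⟩ := hdc g hg0
    have h3 : 0 ≤ θ ⬝ᵥ ((g • Ω + Q⁻¹)⁻¹).mulVec θ := le_trans (by positivity) (h2 θ)
    have h4 : 0 ≤ (g • Ω + Q⁻¹).det := le_trans (by positivity) h1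
    have := hpri_nonneg g hg
    positivity
  have hnum : ∀ θ : EuclideanSpace ℝ (Fin r1), 1 ≤ ‖θ‖ →
      (∫ g in Set.Ioi (0:ℝ), (g • Ω + Q⁻¹).det ^ (-(1:ℝ)/2) *
            (S1 + θ ⬝ᵥ ((g • Ω + Q⁻¹)⁻¹).mulVec θ) ^ (-a) * pri g) ≤
      (d ^ (-(1:ℝ)/2) * c ^ (-a) * (‖θ‖ ^ 2) ^ (-a)) * J := by
    intro θ hθ
    rw [hJ, ← integral_const_mul]
    apply integral_mono_of_nonneg
    · exact (ae_restrict_iff' measurableSet_Ioi).mpr (Eventually.of_forall (hint0 θ))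
    · exact hint.const_mul _
    · refine (ae_restrict_iff' measurableSet_Ioi).mpr (Eventually.of_forall ?_)
      intro g hg
      have hg0 : (0:ℝ) < g := hg
      have hg1 : (0:ℝ) < g + 1 := by linarith
      have hT : 0 < ‖θ‖ ^ 2 := by positivity
      obtain ⟨h1, h2⟩ := hdc g hg0
      have e1 : (g • Ω + Q⁻¹).det ^ (-(1:ℝ)/2) ≤ d ^ (-(1:ℝ)/2) * (g + 1) ^ (-(r1:ℝ)/2) := by
        calc _ ≤ (d * (g + 1) ^ r1) ^ (-(1:ℝ)/2) :=
              Real.rpow_le_rpow_of_nonpos (by positivity) h1 (by norm_num)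
          _ = _ := by
            rw [Real.mul_rpow hd.le (by positivity), ← Real.rpow_natCast, ← Real.rpow_mul hg1.le]
            congr 2; ring
      have e2 : (S1 + θ ⬝ᵥ ((g • Ω + Q⁻¹)⁻¹).mulVec θ) ^ (-a) ≤
          c ^ (-a) * (‖θ‖ ^ 2) ^ (-a) * (g + 1) ^ a := by
        calc _ ≤ (c * ‖θ‖ ^ 2 / (g + 1)) ^ (-a) :=
              Real.rpow_le_rpow_of_nonpos (by positivity) (by linarith [h2 θ]) (by linarith)
          _ = _ := by
            rw [Real.div_rpow (by positivity) hg1.le, Real.mul_rpow hc.le hT.le,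
              Real.rpow_neg hg1.le, div_inv_eq_mul]
      have h3 : 0 ≤ θ ⬝ᵥ ((g • Ω + Q⁻¹)⁻¹).mulVec θ := le_trans (by positivity) (h2 θ)
      have hp := hpri_nonneg g hg
      calc _ ≤ (d ^ (-(1:ℝ)/2) * (g + 1) ^ (-(r1:ℝ)/2)) *
              (c ^ (-a) * (‖θ‖ ^ 2) ^ (-a) * (g + 1) ^ a) * pri g := by
            apply mul_le_mul_of_nonneg_right _ hp
            exact mul_le_mul e1 e2 (by positivity) (by positivity)
        _ = _ := by
            have : ((n:ℝ) - r1 - r2 + ν1) / 2 = -(r1:ℝ)/2 + a := by rw [ha]; ring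
            beta_reduce
            rw [this, Real.rpow_add hg1]
            ring
  have hden : ∀ θ : EuclideanSpace ℝ (Fin r1), 1 ≤ ‖θ‖ →
      (S0 + θ ⬝ᵥ Q.mulVec θ) ^ b ≤ (S0 ^ b + (S0 + K) ^ b) * (‖θ‖ ^ 2) ^ (max b 0) := by
    intro θ hθ
    have hT : 1 ≤ ‖θ‖ ^ 2 := one_le_pow₀ hθ
    have hq := hQn θ
    have hq2 := hKq θ
    have p1 : 0 < S0 ^ b := by positivity
    have p2 : 0 < (S0 + K) ^ b := by positivity
    rcases le_total b 0 with h | h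
    · rw [max_eq_right h, Real.rpow_zero, mul_one]
      have := Real.rpow_le_rpow_of_nonpos hS0p (show S0 ≤ S0 + θ ⬝ᵥ Q.mulVec θ by linarith) h
      linarith
    · rw [max_eq_left h]
      calc _ ≤ ((S0 + K) * ‖θ‖ ^ 2) ^ b := by
            apply Real.rpow_le_rpow (by positivity) _ h
            nlinarith
        _ = (S0 + K) ^ b * (‖θ‖ ^ 2) ^ b := Real.mul_rpow (by positivity) (by positivity)
        _ ≤ _ := by
            gcongr
            linarith
  have hlim : Tendsto Bmix (comap (fun θhat : EuclideanSpace ℝ (Fin r1) => ‖θhat‖) atTop)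
      (nhds 0) := by
    set M : ℝ := (d ^ (-(1:ℝ)/2) * c ^ (-a) * J) * (S0 ^ b + (S0 + K) ^ b) with hM
    have hev : ∀ᶠ θ in comap (fun θhat : EuclideanSpace ℝ (Fin r1) => ‖θhat‖) atTop, 1 ≤ ‖θ‖ :=
      tendsto_comap.eventually (eventually_ge_atTop 1)
    have hlim1 : Tendsto (fun θ : EuclideanSpace ℝ (Fin r1) => M * (‖θ‖ ^ 2) ^ (-(a - max b 0)))
        (comap (fun θhat : EuclideanSpace ℝ (Fin r1) => ‖θhat‖) atTop) (nhds 0) := by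
      have hpos : 0 < a - max b 0 := sub_pos.mpr (max_lt hba ha0)
      have := ((tendsto_rpow_neg_atTop hpos).comp
        ((tendsto_pow_atTop (two_ne_zero)).comp
          (tendsto_comap (f := fun θhat : EuclideanSpace ℝ (Fin r1) => ‖θhat‖)
            (x := (atTop : Filter ℝ))))).const_mul M
      simpa [Function.comp_def] using this
    have hB : ∀ θ, Bmix θ = (∫ g in Set.Ioi (0:ℝ), (g • Ω + Q⁻¹).det ^ (-(1:ℝ)/2) *
            (S1 + θ ⬝ᵥ ((g • Ω + Q⁻¹)⁻¹).mulVec θ) ^ (-a) * pri g) *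
            (S0 + θ ⬝ᵥ Q.mulVec θ) ^ b := by
      intro θ
      rw [hBmix θ, Real.rpow_neg (add_nonneg hS0p.le (hQn θ)), div_inv_eq_mul]
    refine tendsto_of_tendsto_of_tendsto_of_le_of_le' tendsto_const_nhds hlim1 ?_ ?_
    · refine Eventually.of_forall fun θ => ?_
      rw [hB]
      exact mul_nonneg (setIntegral_nonneg measurableSet_Ioi (hint0 θ))
        (Real.rpow_nonneg (add_nonneg hS0p.le (hQn θ)) _)
    · filter_upwards [hev] with θ hθ
      have hT : 0 < ‖θ‖ ^ 2 := by positivity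
      rw [hB]
      calc _ ≤ ((d ^ (-(1:ℝ)/2) * c ^ (-a) * (‖θ‖ ^ 2) ^ (-a)) * J) *
              ((S0 ^ b + (S0 + K) ^ b) * (‖θ‖ ^ 2) ^ (max b 0)) :=
            mul_le_mul (hnum θ hθ) (hden θ hθ)
              (Real.rpow_nonneg (add_nonneg hS0p.le (hQn θ)) _) (by positivity)
        _ = _ := by
            rw [show -(a - max b 0) = -a + max b 0 by ring, Real.rpow_add hT, hM]
            ring
  refine ⟨hlim, ?_⟩
  have : Nonempty (Fin r1) := ⟨⟨0, hr1⟩⟩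
  have hne : (comap (fun θhat : EuclideanSpace ℝ (Fin r1) => ‖θhat‖) atTop).NeBot := by
    rw [comap_norm_atTop]
    infer_instance
  intro h
  exact not_tendsto_nhds_of_tendsto_atTop h 0 hlim
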